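/- Assume N is even, N ≥ 6, and ⟨L_{N−1},L_{N−2}⟩₁·⟨L_{N−3},L_{N−4}⟩₁ ≠ 0. Then the skew products of Laguerre polynomials satisfy the two identities: ⟨L_{N+1}, L_{N−1}⟩₁ = ((N−1)(M−1)/M²)·⟨L_N, L_{N−2}⟩₁ and ⟨L_{N+1}, L_{N−2}⟩₁ = ((Mt − (N+M))/M)·⟨L_N, L_{N−2}⟩₁. -/

import Mathlib

open MeasureTheory Polynomial Set

noncomputable section

/-- The weight `w(x) = e^{−Mx/2}·x^{(M−N−1)/2}·(t−x)^{−1/2}` on `(0,∞)`,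
using the principal branch of the complex power. -/
def wC (M N : ℕ) (t : ℂ) (x : ℝ) : ℂ :=
  Complex.exp (-(M : ℂ) * x / 2) * (x : ℂ) ^ (((((M : ℝ) - N - 1) / 2 : ℝ)) : ℂ) *
    (t - x) ^ (-(1 / 2) : ℂ)

/-- The Laguerre weight `w₀(x) = x^{M−N}·e^{−Mx}`. -/
def w0R (M N : ℕ) (x : ℝ) : ℝ := x ^ (M - N) * Real.exp (-(M : ℝ) * x)

/-- The skew product `⟨f,g⟩₁ = ∫₀^∞∫₀^∞ (1/2)·sgn(x−y)·f(x)·g(y)·w(x)·w(y) dy dx`. -/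
def skew1 (M N : ℕ) (t : ℂ) (f g : Polynomial ℂ) : ℂ :=
  ∫ x in Ioi (0 : ℝ), ∫ y in Ioi (0 : ℝ),
    ((Real.sign (x - y) : ℝ) : ℂ) / 2 * f.eval (x : ℂ) * g.eval (y : ℂ) *
      wC M N t x * wC M N t y

/-- The inner product `⟨f,g⟩₂ = ∫₀^∞ f(x)·g(x)·w₀(x) dx`. -/
def inner2C (M N : ℕ) (f g : Polynomial ℂ) : ℂ :=
  ∫ x in Ioi (0 : ℝ), f.eval (x : ℂ) * g.eval (x : ℂ) * (w0R M N x : ℂ)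

/-- `IsLag M N L` says that `L n` is the monic degree-`n` orthogonal polynomial for the
weight `w₀` (the rescaled Laguerre polynomial). -/
def IsLag (M N : ℕ) (L : ℕ → Polynomial ℂ) : Prop :=
  ∀ n, (L n).Monic ∧ (L n).natDegree = n ∧
    ∀ j, j < n → inner2C M N (L n) (Polynomial.X ^ j) = 0

/-- The operator `T(q)(x) = x(t−x)q′(x) +
[(t−2x) − (M/2)x(t−x) + ((M−N−1)/2)(t−x) + x/2]·q(x)`,
i.e. formally `T(q) = (d/dx)(q·x·(t−x)·w)/w`. -/
def Tq (M N : ℕ) (t : ℂ) (q : Polynomial ℂ) : Polynomial ℂ :=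
  Polynomial.X * (Polynomial.C t - Polynomial.X) * Polynomial.derivative q +
    ((Polynomial.C t - 2 * Polynomial.X)
        - Polynomial.C ((M : ℂ) / 2) * (Polynomial.X * (Polynomial.C t - Polynomial.X))
        + Polynomial.C (((M : ℂ) - N - 1) / 2) * (Polynomial.C t - Polynomial.X)
        + Polynomial.C (1 / 2) * Polynomial.X) * q

/-- `ε(f)(x) = ∫₀^∞ (1/2)·sgn(x−y)·f(y) dy`. -/
def epsC (f : ℝ → ℂ) (x : ℝ) : ℂ :=
  ∫ y in Ioi (0 : ℝ), ((Real.sign (x - y) : ℝ) : ℂ) / 2 * f y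

/-- The squared norm `h_{n,0} = ∫₀^∞ L_n(x)²·w₀(x) dx`. -/
def hC (M N : ℕ) (L : ℕ → Polynomial ℂ) (n : ℕ) : ℂ :=
  ∫ x in Ioi (0 : ℝ), (L n).eval (x : ℂ) ^ 2 * (w0R M N x : ℂ)

end

theorem Tq_add (M N : ℕ) (t : ℂ) (p q : ℂ[X]) :
    Tq M N t (p + q) = Tq M N t p + Tq M N t q := by
  simp only [Tq, derivative_add]
  ring

theorem coeff_X_mul_derivative (q : ℂ[X]) (k : ℕ) :
    (X * derivative q).coeff k = k * q.coeff k := by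
  cases k with
  | zero => simp
  | succ k => rw [coeff_X_mul, coeff_derivative]; push_cast; ring

theorem coeff_Tq (M N : ℕ) (t : ℂ) (q : ℂ[X]) (k : ℕ) :
    (Tq M N t q).coeff (k + 2) =
      t * (k + 2 + 1 + ((M : ℂ) - N - 1) / 2) * q.coeff (k + 2)
        - (k + 1 + 1 + (M : ℂ) / 2 * t + ((M : ℂ) - N) / 2) * q.coeff (k + 1)
        + (M : ℂ) / 2 * q.coeff k := by
  have h : Tq M N t q = C t * (X * derivative q) - X * (X * derivative q)
      + C (t + ((M : ℂ) - N - 1) / 2 * t) * q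
      + C (-2 - (M : ℂ) / 2 * t - ((M : ℂ) - N - 1) / 2 + 1 / 2) * (X * q)
      + C ((M : ℂ) / 2) * (X * (X * q)) := by
    simp only [Tq, C_add, C_sub, C_mul, C_neg, C_ofNat]
    ring
  rw [h]
  simp only [coeff_add, coeff_sub, coeff_C_mul, coeff_X_mul, coeff_derivative]
  push_cast
  ring

/-- Division with remainder by the image of `Tq`, which raises degrees by two. -/
theorem exists_eq_Tq_add_linear (M N : ℕ) (hM : (M : ℂ) ≠ 0) (t : ℂ) (n : ℕ) :
    ∀ p : ℂ[X], p.degree < ((n + 2 : ℕ) : WithBot ℕ) →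
      ∃ (q : ℂ[X]) (a b : ℂ), q.degree < (n : WithBot ℕ) ∧
        p = Tq M N t q + (C a + C b * X) := by
  induction n with
  | zero =>
    intro p hp
    have hp1 : p.degree ≤ 1 := by
      rw [← Nat.cast_one, degree_le_iff_coeff_zero]
      intro m hm
      rw [degree_lt_iff_coeff_zero] at hp
      exact hp m (by have := Nat.cast_lt.1 hm; omega)
    refine ⟨0, p.coeff 0, p.coeff 1, by simp, ?_⟩
    conv_lhs => rw [eq_X_add_C_of_degree_le_one hp1]
    simp [Tq]
    ring
  | succ n ih =>
    intro p hp
    rw [degree_lt_iff_coeff_zero] at hp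
    set m : ℂ[X] := C (2 / (M : ℂ) * p.coeff (n + 2)) * X ^ n with hm
    obtain ⟨q, a, b, hq, h⟩ := ih (p - Tq M N t m) (by
      rw [degree_lt_iff_coeff_zero]
      intro k hk
      obtain ⟨j, rfl⟩ : ∃ j, k = j + 2 := ⟨k - 2, by omega⟩
      rw [coeff_sub, coeff_Tq]
      simp only [hm, coeff_C_mul, coeff_X_pow]
      rw [if_neg (by omega : ¬ j + 2 = n), if_neg (by omega : ¬ j + 1 = n)]
      by_cases hj : j = n
      · subst hj
        simp only [if_true]
        field_simp
        ring
      · rw [if_neg hj, hp _ (by omega)]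
        ring)
    refine ⟨q + m, a, b, ?_, ?_⟩
    · refine lt_of_le_of_lt (degree_add_le _ _) (max_lt (hq.trans ?_) ?_)
      · exact_mod_cast Nat.lt_succ_self n
      · refine lt_of_le_of_lt (degree_C_mul_X_pow_le _ _) ?_
        exact_mod_cast Nat.lt_succ_self n
    · rw [Tq_add]
      linear_combination h

section Laguerre

/-- Orthogonality of `L n` to lower powers evaluates the functional on `L n * p`. -/
theorem functional_mul_eq (l : ℂ[X] →ₗ[ℂ] ℂ) (L : ℕ → ℂ[X])
    (horth : ∀ n j, j < n → l (L n * X ^ j) = 0) (n : ℕ) (p : ℂ[X])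
    (hp : ∀ k, n < k → p.coeff k = 0) :
    l (L n * p) = p.coeff n * l (L n * X ^ n) := by
  have hp' : p.natDegree < n + 1 := by
    rw [Nat.lt_succ_iff, natDegree_le_iff_coeff_eq_zero]
    exact hp
  conv_lhs => rw [as_sum_range_C_mul_X_pow' p hp']
  rw [Finset.mul_sum, map_sum, Finset.sum_range_succ, Finset.sum_eq_zero, zero_add]
  · rw [mul_left_comm, ← smul_eq_C_mul, map_smul, smul_eq_mul]
  · intro j hj
    rw [mul_left_comm, ← smul_eq_C_mul, map_smul, horth n j (Finset.mem_range.1 hj), smul_zero]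

variable (l : ℂ[X] →ₗ[ℂ] ℂ) (L : ℕ → ℂ[X]) (m α : ℂ)

theorem coeff_self_of_monic (hmon : ∀ n, (L n).Monic) (hdeg : ∀ n, (L n).natDegree = n) (n : ℕ) :
    (L n).coeff n = 1 := by
  have := (hmon n).coeff_natDegree
  rwa [hdeg] at this

theorem coeff_eq_zero_of_natDegree (hdeg : ∀ n, (L n).natDegree = n) {n k : ℕ} (h : n < k) :
    (L n).coeff k = 0 :=
  coeff_eq_zero_of_natDegree_lt (by rw [hdeg]; exact h)

theorem laguerre_norm_succ (hmon : ∀ n, (L n).Monic) (hdeg : ∀ n, (L n).natDegree = n)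
    (horth : ∀ n j, j < n → l (L n * X ^ j) = 0)
    (hl : ∀ p, l (X * derivative p) + (α + 1) * l p = m * l (X * p)) (n : ℕ) :
    m * l (L (n + 1) * X ^ (n + 1)) = -(L (n + 1)).coeff n * l (L n * X ^ n) := by
  have h1 := coeff_self_of_monic L hmon hdeg
  have h0 : ∀ {n k : ℕ}, n < k → (L n).coeff k = 0 := coeff_eq_zero_of_natDegree L hdeg
  have hLL : l (L (n + 1) * L n) = 0 := by
    rw [functional_mul_eq l L horth _ _ fun k hk => h0 (by omega), h0 (by omega), zero_mul]
  have hA : l (X * (L (n + 1) * L n)) = l (L (n + 1) * X ^ (n + 1)) := by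
    rw [mul_left_comm, functional_mul_eq l L horth, coeff_X_mul, h1, one_mul]
    intro k hk
    obtain ⟨j, rfl⟩ : ∃ j, k = j + 1 := ⟨k - 1, by omega⟩
    rw [coeff_X_mul, h0 (by omega)]
  have hB : l (L (n + 1) * (X * derivative (L n))) = 0 := by
    rw [functional_mul_eq l L horth, coeff_X_mul_derivative, h0 (by omega), mul_zero, zero_mul]
    intro k hk
    rw [coeff_X_mul_derivative, h0 (by omega), mul_zero]
  have hC : l (L n * (X * derivative (L (n + 1)) - C ((n : ℂ) + 1) * L (n + 1)))
      = -(L (n + 1)).coeff n * l (L n * X ^ n) := by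
    rw [functional_mul_eq l L horth, coeff_sub, coeff_X_mul_derivative, coeff_C_mul]
    · ring
    · intro k hk
      rw [coeff_sub, coeff_X_mul_derivative, coeff_C_mul]
      rcases (Nat.succ_le_of_lt hk).eq_or_lt with rfl | hk'
      · push_cast; ring
      · rw [h0 hk']; ring
  have hC' : l (L n * (X * derivative (L (n + 1))))
      = -(L (n + 1)).coeff n * l (L n * X ^ n) := by
    rw [← hC, mul_sub, map_sub, mul_left_comm (L n) (C _), ← smul_eq_C_mul, map_smul,
      mul_comm (L n) (L (n + 1)), hLL, smul_zero, sub_zero]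
  have := hl (L (n + 1) * L n)
  rw [hLL, hA, derivative_mul, mul_add, map_add] at this
  rw [← this, ← hC', mul_zero, add_zero]
  rw [show X * (L (n + 1) * derivative (L n)) = L (n + 1) * (X * derivative (L n)) by ring, hB,
    add_zero]
  congr 1
  ring

theorem laguerre_coeff_sub (hmon : ∀ n, (L n).Monic) (hdeg : ∀ n, (L n).natDegree = n)
    (horth : ∀ n j, j < n → l (L n * X ^ j) = 0)
    (hl : ∀ p, l (X * derivative p) + (α + 1) * l p = m * l (X * p)) (n : ℕ)
    (hn : l (L n * X ^ n) ≠ 0) :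
    m * ((X * L n).coeff n - (L (n + 1)).coeff n) = 2 * n + α + 1 := by
  have h1 := coeff_self_of_monic L hmon hdeg
  have h0 : ∀ {n k : ℕ}, n < k → (L n).coeff k = 0 := coeff_eq_zero_of_natDegree L hdeg
  have hsq : l (L n * L n) = l (L n * X ^ n) := by
    rw [functional_mul_eq l L horth _ _ fun k hk => h0 hk, h1, one_mul]
  have hLL : l (L n * L (n + 1)) = 0 := by
    rw [mul_comm, functional_mul_eq l L horth _ _ fun k hk => h0 (by omega), h0 (by omega),
      zero_mul]
  have hA : l (L n * (X * L n - L (n + 1)))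
      = ((X * L n).coeff n - (L (n + 1)).coeff n) * l (L n * X ^ n) := by
    rw [functional_mul_eq l L horth, coeff_sub]
    intro k hk
    obtain ⟨j, rfl⟩ : ∃ j, k = j + 1 := ⟨k - 1, by omega⟩
    rw [coeff_sub, coeff_X_mul]
    rcases (Nat.lt_succ_iff.1 hk).eq_or_lt with rfl | hk'
    · rw [h1, h1, sub_self]
    · rw [h0 hk', h0 (by omega), sub_self]
  have hB : l (L n * (X * derivative (L n))) = n * l (L n * X ^ n) := by
    rw [functional_mul_eq l L horth, coeff_X_mul_derivative, h1, mul_one]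
    intro k hk
    rw [coeff_X_mul_derivative, h0 (by omega), mul_zero]
  rw [mul_sub, map_sub, hLL, sub_zero] at hA
  have := hl (L n * L n)
  rw [hsq, derivative_mul, mul_add, map_add, mul_left_comm X (L n) (L n), hA,
    mul_left_comm X (L n) (derivative _), hB,
    show X * (derivative (L n) * L n) = L n * (X * derivative (L n)) by ring, hB] at this
  apply mul_right_cancel₀ hn
  linear_combination -this

/-- The subleading coefficients and norms of the orthogonal polynomials of a functional
satisfying the Pearson equation of the Laguerre weight `x ^ α * exp (-m * x)`. -/
theorem laguerre_coeff_and_norm (hmon : ∀ n, (L n).Monic) (hdeg : ∀ n, (L n).natDegree = n)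
    (horth : ∀ n j, j < n → l (L n * X ^ j) = 0)
    (hl : ∀ p, l (X * derivative p) + (α + 1) * l p = m * l (X * p))
    (hα : ∀ n : ℕ, (n : ℂ) + 1 + α ≠ 0) (h1 : l 1 ≠ 0) (n : ℕ) :
    m * (X * L n).coeff n = -(n * (n + α)) ∧ l (L n * X ^ n) ≠ 0 := by
  induction n with
  | zero =>
    have : L 0 = 1 := (hmon 0).natDegree_eq_zero.1 (hdeg 0)
    simp [this, h1]
  | succ n ih =>
    have hc := laguerre_coeff_sub l L m α hmon hdeg horth hl n ih.2
    have hn := laguerre_norm_succ l L m α hmon hdeg horth hl n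
    have hc' : m * (L (n + 1)).coeff n = -((n + 1) * (n + 1 + α)) := by
      linear_combination ih.1 - hc
    refine ⟨by rw [coeff_X_mul, hc']; push_cast; ring, fun h => ?_⟩
    rw [h, mul_zero, eq_comm, mul_eq_zero] at hn
    rcases hn with hn | hn
    · rw [neg_eq_zero.1 hn, mul_zero, eq_comm, neg_eq_zero, mul_eq_zero] at hc'
      rcases hc' with h' | h'
      · exact Nat.cast_add_one_ne_zero n h'
      · exact hα n h'
    · exact ih.2 hn

end Laguerre

section Skew

variable (M N : ℕ) (t : ℂ) (l : ℂ[X] →ₗ[ℂ] ℂ) (B : ℂ[X] →ₗ[ℂ] ℂ[X] →ₗ[ℂ] ℂ)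
  (L : ℕ → ℂ[X])

theorem skew_Tq_eq_zero (horth : ∀ n j, j < n → l (L n * X ^ j) = 0)
    (hB : ∀ f q, B f (Tq M N t q) = l (f * q)) {n : ℕ} (k : ℕ) (hk : n ≤ k) (q : ℂ[X])
    (hq : q.degree < (n : WithBot ℕ)) : B (L k) (Tq M N t q) = 0 := by
  rw [degree_lt_iff_coeff_zero] at hq
  rw [hB, functional_mul_eq l L horth _ _ fun j hj => hq j (by omega), hq k hk, zero_mul]

/-- A functional annihilating `Tq q` for `deg q < n` is determined on polynomials of degree at
most `n + 1` by its values at `L n` and `L (n + 1)`. -/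
theorem functional_eq_zero (hM : (M : ℂ) ≠ 0) (hdeg : ∀ n, (L n).natDegree = n)
    (horth : ∀ n j, j < n → l (L n * X ^ j) = 0) (hskew : ∀ f g, B f g = -B g f)
    (hB : ∀ f q, B f (Tq M N t q) = l (f * q)) (n : ℕ) (ha : B (L (n + 1)) (L n) ≠ 0)
    (φ : ℂ[X] →ₗ[ℂ] ℂ) (hφ : ∀ q : ℂ[X], q.degree < (n : WithBot ℕ) → φ (Tq M N t q) = 0)
    (h0 : φ (L n) = 0) (h1 : φ (L (n + 1)) = 0) (p : ℂ[X])
    (hp : p.degree < ((n + 2 : ℕ) : WithBot ℕ)) : φ p = 0 := by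
  have hself : ∀ f, B f f = 0 := fun f => by
    have := hskew f f
    linear_combination (1 / 2 : ℂ) * this
  have hdeg' : ∀ k < n + 2, (L k).degree < ((n + 2 : ℕ) : WithBot ℕ) := fun k hk => by
    refine lt_of_le_of_lt degree_le_natDegree ?_
    rw [hdeg]
    exact_mod_cast hk
  have hlin : ∀ (ψ : ℂ[X] →ₗ[ℂ] ℂ) (a b : ℂ), ψ (C a + C b * X) = a * ψ 1 + b * ψ X :=
    fun ψ a b => by
      rw [map_add, ← smul_eq_C_mul, ← mul_one (C a), ← smul_eq_C_mul, map_smul, map_smul]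
      rfl
  have hBz := skew_Tq_eq_zero M N t l B L horth hB (n := n)
  obtain ⟨q₀, a₀, b₀, hq₀, e₀⟩ := exists_eq_Tq_add_linear M N hM t n _ (hdeg' n (by omega))
  obtain ⟨q₁, a₁, b₁, hq₁, e₁⟩ := exists_eq_Tq_add_linear M N hM t n _ (hdeg' (n + 1) (by omega))
  obtain ⟨q, a, b, hq, e⟩ := exists_eq_Tq_add_linear M N hM t n p hp
  have key₀ : ∀ ψ : ℂ[X] →ₗ[ℂ] ℂ, (∀ q : ℂ[X], q.degree < (n : WithBot ℕ) →
      ψ (Tq M N t q) = 0) → ψ (L n) = a₀ * ψ 1 + b₀ * ψ X := fun ψ hψ => by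
    rw [e₀, map_add, hψ _ hq₀, zero_add, hlin]
  have key₁ : ∀ ψ : ℂ[X] →ₗ[ℂ] ℂ, (∀ q : ℂ[X], q.degree < (n : WithBot ℕ) →
      ψ (Tq M N t q) = 0) → ψ (L (n + 1)) = a₁ * ψ 1 + b₁ * ψ X := fun ψ hψ => by
    rw [e₁, map_add, hψ _ hq₁, zero_add, hlin]
  have hz₀ := hBz n le_rfl
  have hz₁ := hBz (n + 1) (Nat.le_succ n)
  have hdet : a₀ * b₁ - a₁ * b₀ ≠ 0 := fun hd => by
    have e00 := key₀ _ hz₀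
    have e10 := key₀ _ hz₁
    have e01 := key₁ _ hz₀
    have e11 := key₁ _ hz₁
    rw [hself] at e00 e11
    rw [hskew] at e01
    have : B (L (n + 1)) (L n) * B (L (n + 1)) (L n) = 0 := by
      linear_combination B (L (n + 1)) (L n) * e10
        + (a₀ * B (L (n + 1)) 1 + b₀ * B (L (n + 1)) X) * (-e01)
        - (a₁ * B (L (n + 1)) 1 + b₁ * B (L (n + 1)) X) * (-e00)
        + (B (L n) 1 * B (L (n + 1)) X - B (L n) X * B (L (n + 1)) 1) * hd
    exact ha (mul_self_eq_zero.1 this)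
  rw [key₀ φ hφ] at h0
  rw [key₁ φ hφ] at h1
  have g1 : φ 1 = 0 := by
    apply (mul_eq_zero.1 _).resolve_left hdet
    linear_combination b₁ * h0 - b₀ * h1
  have gX : φ X = 0 := by
    apply (mul_eq_zero.1 _).resolve_left hdet
    linear_combination a₀ * h1 - a₁ * h0
  rw [e, map_add, hφ q hq, hlin, g1, gX]
  ring

theorem skew_product_identities (hM : (M : ℂ) ≠ 0) (hmon : ∀ n, (L n).Monic)
    (hdeg : ∀ n, (L n).natDegree = n) (horth : ∀ n j, j < n → l (L n * X ^ j) = 0)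
    (hskew : ∀ f g, B f g = -B g f) (hB : ∀ f q, B f (Tq M N t q) = l (f * q))
    (hl : ∀ p, l (X * derivative p) + ((M : ℂ) - N + 1) * l p = M * l (X * p))
    (hα : ∀ n : ℕ, (n : ℂ) + 1 + ((M : ℂ) - N) ≠ 0) (hl1 : l 1 ≠ 0)
    (n : ℕ) (ha : B (L (n + 1)) (L n) ≠ 0) :
    B (L (n + 3)) (L (n + 1))
        = ((n : ℂ) + 1) * (n + 1 + (M - N)) / (M : ℂ) ^ 2 * B (L (n + 2)) (L n) ∧
      B (L (n + 3)) (L n)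
        = (M * t - (2 * n + 4 + (M - N))) / (M : ℂ) * B (L (n + 2)) (L n) := by
  have h1 := coeff_self_of_monic L hmon hdeg
  have h0 : ∀ {n k : ℕ}, n < k → (L n).coeff k = 0 := coeff_eq_zero_of_natDegree L hdeg
  have hself : ∀ f, B f f = 0 := fun f => by
    have := hskew f f
    linear_combination (1 / 2 : ℂ) * this
  have lag := laguerre_coeff_and_norm l L M ((M : ℂ) - N) hmon hdeg horth hl hα hl1
  set β : ℂ := -((M * t - (2 * n + 4 + (M - N))) / 2) with hβ
  set κ : ℂ := (M : ℂ) / 2 with hκ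
  set R : ℂ[X] := Tq M N t (L n) - C κ * L (n + 2) with hR
  set S : ℂ[X] := Tq M N t (L (n + 1)) - C κ * L (n + 3) - C β * L (n + 2) with hS
  have hRd : R.degree < ((n + 2 : ℕ) : WithBot ℕ) := by
    rw [degree_lt_iff_coeff_zero]
    intro k hk
    obtain ⟨j, rfl⟩ : ∃ j, k = j + 2 := ⟨k - 2, by omega⟩
    rw [hR, coeff_sub, coeff_Tq, coeff_C_mul, h0 (by omega : n < j + 2),
      h0 (by omega : n < j + 1)]
    rcases (show n ≤ j by omega).eq_or_lt with rfl | hj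
    · rw [h1, h1]; ring
    · rw [h0 hj, h0 (by omega : n + 2 < j + 2)]; ring
  have hSd : S.degree < ((n + 2 : ℕ) : WithBot ℕ) := by
    rw [degree_lt_iff_coeff_zero]
    intro k hk
    obtain ⟨j, rfl⟩ : ∃ j, k = j + 2 := ⟨k - 2, by omega⟩
    rw [hS, coeff_sub, coeff_sub, coeff_Tq, coeff_C_mul, coeff_C_mul,
      h0 (by omega : n + 1 < j + 2)]
    rcases (show n ≤ j by omega).eq_or_lt with rfl | hj
    · have c1 := (lag (n + 1)).1
      have c3 := (lag (n + 3)).1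
      rw [coeff_X_mul] at c1 c3
      rw [h1, h1, hβ, hκ]
      push_cast at c1 c3
      linear_combination (1 / 2 : ℂ) * c1 - (1 / 2 : ℂ) * c3
    · rw [h0 (by omega : n + 1 < j + 1), h0 (by omega : n + 2 < j + 2)]
      rcases (show n + 1 ≤ j by omega).eq_or_lt with rfl | hj'
      · rw [h1, h1]; ring
      · rw [h0 hj', h0 (by omega : n + 3 < j + 2)]; ring
  have hφ : ∀ k, n ≤ k → ∀ p : ℂ[X], p.degree < ((n + 2 : ℕ) : WithBot ℕ) →
      B (L (n + 1)) (L n) * B (L k) p - B (L k) (L n) * B (L (n + 1)) p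
        + B (L k) (L (n + 1)) * B (L n) p = 0 := by
    intro k hk p hp
    have hBz := skew_Tq_eq_zero M N t l B L horth hB (n := n)
    have := functional_eq_zero M N t l B L hM hdeg horth hskew hB n ha
      (B (L (n + 1)) (L n) • B (L k) - B (L k) (L n) • B (L (n + 1))
        + B (L k) (L (n + 1)) • B (L n)) (fun q hq => by
          simp [hBz k hk q hq, hBz n le_rfl q hq, hBz (n + 1) (by omega) q hq])
      (by simp [hself]; ring) (by
        simp only [LinearMap.add_apply, LinearMap.sub_apply, LinearMap.smul_apply, smul_eq_mul,
          hself, hskew (L n) (L (n + 1))]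
        ring) p hp
    simpa using this
  have hLL : ∀ {i j : ℕ}, i < j → l (L j * L i) = 0 := fun {i j} hij => by
    rw [functional_mul_eq l L horth _ _ fun k hk => h0 (by omega), h0 hij, zero_mul]
  have hsq : ∀ n, l (L n * L n) = l (L n * X ^ n) := fun n => by
    rw [functional_mul_eq l L horth _ _ fun k hk => h0 hk, h1, one_mul]
  have BR : ∀ f, B f R = l (f * L n) - κ * B f (L (n + 2)) := fun f => by
    rw [hR, map_sub, hB, ← smul_eq_C_mul, map_smul, smul_eq_mul]
  have BS : ∀ f, B f S = l (f * L (n + 1)) - κ * B f (L (n + 3)) - β * B f (L (n + 2)) :=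
    fun f => by
      rw [hS, map_sub, map_sub, hB, ← smul_eq_C_mul, ← smul_eq_C_mul, map_smul, map_smul]
      rfl
  have e2R := hφ (n + 2) (by omega) R hRd
  have e3R := hφ (n + 3) (by omega) R hRd
  have e2S := hφ (n + 2) (by omega) S hSd
  have e3S := hφ (n + 3) (by omega) S hSd
  have hc := (lag (n + 1)).1
  have hn := laguerre_norm_succ l L M ((M : ℂ) - N) hmon hdeg horth hl n
  rw [coeff_X_mul] at hc
  push_cast at hc
  have hh0 := (lag n).2
  have hh1 := (lag (n + 1)).2
  rw [BR, BR, BR, hself, hLL (by omega : n < n + 2), hLL (by omega : n < n + 1), hsq,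
    hskew (L (n + 1)) (L (n + 2)), hskew (L n) (L (n + 2))] at e2R
  rw [BR, BR, BR, hLL (by omega : n < n + 3), hLL (by omega : n < n + 1), hsq,
    hskew (L (n + 1)) (L (n + 2)), hskew (L n) (L (n + 2))] at e3R
  rw [BS, BS, BS, hself, hLL (by omega : n + 1 < n + 2), hsq, mul_comm (L n) (L (n + 1)),
    hLL (by omega : n < n + 1), hskew (L (n + 2)) (L (n + 3)), hskew (L (n + 1)) (L (n + 3)),
    hskew (L (n + 1)) (L (n + 2)), hskew (L n) (L (n + 3)), hskew (L n) (L (n + 2))] at e2S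
  rw [BS, BS, BS, hself, hLL (by omega : n + 1 < n + 3), hsq, mul_comm (L n) (L (n + 1)),
    hLL (by omega : n < n + 1), hskew (L (n + 1)) (L (n + 3)),
    hskew (L (n + 1)) (L (n + 2)), hskew (L n) (L (n + 3)), hskew (L n) (L (n + 2))] at e3S
  have hy : B (L (n + 2)) (L (n + 1)) = 0 := by
    apply (mul_eq_zero.1 _).resolve_right hh0
    linear_combination e2R
  rw [hy] at e3R e2S e3S
  constructor
  · apply mul_right_cancel₀ hh0
    have hv : B (L (n + 3)) (L (n + 1)) * l (L n * X ^ n)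
        = B (L (n + 2)) (L n) * l (L (n + 1) * X ^ (n + 1)) := by
      linear_combination e3R + e2S
    rw [hv]
    field_simp
    linear_combination B (L (n + 2)) (L n) * (M * hn - l (L n * X ^ n) * hc)
  · have hu : κ * B (L (n + 3)) (L n) = -β * B (L (n + 2)) (L n) := by
      apply mul_right_cancel₀ hh1
      linear_combination -κ * e3S - β * e2S
    rw [hκ, hβ] at hu
    field_simp
    linear_combination 2 * hu

end Skew

section Weight

variable {M N : ℕ} {t : ℂ}

theorem sub_ofReal_mem_slitPlane (ht : t.im ≠ 0) (x : ℝ) : t - x ∈ Complex.slitPlane := by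
  right
  simpa using ht

theorem continuous_sub_ofReal_cpow (ht : t.im ≠ 0) :
    Continuous fun x : ℝ => (t - x) ^ (-(1 / 2) : ℂ) :=
  continuous_iff_continuousAt.2 fun x => ContinuousAt.cpow (by fun_prop) (by fun_prop)
    (sub_ofReal_mem_slitPlane ht x)

theorem norm_sub_ofReal_cpow_le (ht : t.im ≠ 0) (x : ℝ) :
    ‖(t - x) ^ (-(1 / 2) : ℂ)‖ ≤ |t.im| ^ (-(1 / 2) : ℝ) := by
  have h : (-(1 / 2) : ℂ) = ((-(1 / 2) : ℝ) : ℂ) := by push_cast; ring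
  rw [h, Complex.norm_cpow_real]
  refine Real.rpow_le_rpow_of_nonpos (abs_pos.2 ht) ?_ (by norm_num)
  simpa using Complex.abs_im_le_norm (t - x)

theorem half_sub_nonneg (hNM : N < M) : 0 ≤ ((M : ℝ) - N - 1) / 2 := by
  have : (N : ℝ) + 1 ≤ M := by exact_mod_cast hNM
  linarith

theorem wC_eq {x : ℝ} (hx : 0 ≤ x) :
    wC M N t x = Complex.exp (-(M : ℂ) * x / 2) * ((x ^ (((M : ℝ) - N - 1) / 2) : ℝ) : ℂ) *
      (t - x) ^ (-(1 / 2) : ℂ) := by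
  rw [wC, Complex.ofReal_cpow hx]

theorem continuousOn_wC (hNM : N < M) (ht : t.im ≠ 0) : ContinuousOn (wC M N t) (Ici 0) := by
  refine ContinuousOn.congr (Continuous.continuousOn ?_) fun x hx => wC_eq hx
  have h := continuous_sub_ofReal_cpow ht
  have h' : Continuous fun x : ℝ => x ^ (((M : ℝ) - N - 1) / 2) :=
    Real.continuous_rpow_const (half_sub_nonneg hNM)
  fun_prop

theorem integrableOn_eval_mul_wC (hNM : N < M) (ht : t.im ≠ 0) (p : ℂ[X]) :
    IntegrableOn (fun x : ℝ => p.eval (x : ℂ) * wC M N t x) (Ioi 0) := by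
  induction p using Polynomial.induction_on' with
  | add p q hp hq =>
    refine (hp.add hq).congr_fun (fun x _ => ?_) measurableSet_Ioi
    simp [add_mul]
  | monomial k a =>
    have hr := half_sub_nonneg hNM
    have hM : 0 < (M : ℝ) / 2 := by
      have : (0 : ℝ) < M := by exact_mod_cast Nat.zero_lt_of_lt hNM
      linarith
    have h1 := (integrableOn_rpow_mul_exp_neg_mul_rpow
      (s := ((M : ℝ) - N - 1) / 2 + k) (neg_one_lt_zero.trans_le (by positivity)) one_pos
      hM).ofReal (𝕜 := ℂ)
    have h2 := (h1.mul_bdd (c := |t.im| ^ (-(1 / 2) : ℝ))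
      (continuous_sub_ofReal_cpow ht).aestronglyMeasurable
      (Filter.Eventually.of_forall (norm_sub_ofReal_cpow_le ht))).const_mul a
    refine IntegrableOn.congr_fun h2 (fun x hx => ?_) measurableSet_Ioi
    have hx0 : 0 < x := hx
    simp only [eval_monomial, wC_eq hx0.le, Real.rpow_one, Real.rpow_add hx0, Real.rpow_natCast,
      RCLike.ofReal_eq_complex_ofReal]
    push_cast
    rw [show -(M : ℂ) * x / 2 = -((M : ℂ) / 2) * x by ring]
    ring

theorem hasDerivAt_eval_mul_wC (ht : t.im ≠ 0) (q : ℂ[X]) {x : ℝ} (hx : 0 < x) :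
    HasDerivAt (fun y : ℝ => q.eval (y : ℂ) * (y * (t - y)) * wC M N t y)
      ((Tq M N t q).eval (x : ℂ) * wC M N t x) x := by
  have hx0 : (x : ℂ) ≠ 0 := Complex.ofReal_ne_zero.2 hx.ne'
  have htx := sub_ofReal_mem_slitPlane ht x
  have htx0 := Complex.slitPlane_ne_zero htx
  set r : ℂ := ((((M : ℝ) - N - 1) / 2 : ℝ) : ℂ) with hr
  have hlin : HasDerivAt (fun z : ℂ => t - z) (-1) (x : ℂ) := by
    simpa using (hasDerivAt_id (x : ℂ)).const_sub t
  have hexp : HasDerivAt (fun z : ℂ => Complex.exp (-(M : ℂ) * z / 2))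
      (Complex.exp (-(M : ℂ) * x / 2) * (-(M : ℂ) / 2)) (x : ℂ) := by
    have := (((hasDerivAt_id (x : ℂ)).const_mul (-(M : ℂ))).div_const 2).cexp
    simpa using this
  have hpow : HasDerivAt (fun z : ℂ => z ^ r) (r * (x : ℂ) ^ (r - 1) * 1) (x : ℂ) :=
    (hasDerivAt_id (x : ℂ)).cpow_const (Complex.ofReal_mem_slitPlane.2 hx)
  have hsq := hlin.cpow_const (c := (-(1 / 2) : ℂ)) htx
  have h := (((q.hasDerivAt (x : ℂ)).mul ((hasDerivAt_id (x : ℂ)).mul hlin)).mul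
    ((hexp.mul hpow).mul hsq)).comp_ofReal
  refine h.congr_deriv ?_
  simp only [Pi.mul_apply, id_eq, wC, Tq, ← hr, Complex.cpow_sub _ _ hx0,
    Complex.cpow_sub _ _ htx0, Complex.cpow_one, eval_add, eval_sub, eval_mul, eval_X, eval_C,
    eval_ofNat]
  have hr' : r = ((M : ℂ) - N - 1) / 2 := by rw [hr]; push_cast; ring
  rw [← hr']
  field_simp
  ring

theorem mul_wC_mul_wC (hNM : N < M) (ht : t.im ≠ 0) {x : ℝ} (hx : 0 < x) :
    x * (t - x) * (wC M N t x * wC M N t x) = (w0R M N x : ℂ) := by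
  have htx0 := Complex.slitPlane_ne_zero (sub_ofReal_mem_slitPlane ht x)
  have h1 : (t - x) ^ (-(1 / 2) : ℂ) * (t - x) ^ (-(1 / 2) : ℂ) = (t - x)⁻¹ := by
    rw [← Complex.cpow_add _ _ htx0, ← Complex.cpow_neg_one]
    norm_num
  have h2 : x * (x ^ (((M : ℝ) - N - 1) / 2) * x ^ (((M : ℝ) - N - 1) / 2)) = x ^ (M - N) := by
    rw [← Real.rpow_add hx, ← Real.rpow_one_add' hx.le, ← Real.rpow_natCast, Nat.cast_sub hNM.le]
    · congr 1; ring
    · have := half_sub_nonneg hNM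
      linarith
  have h3 : Complex.exp (-(M : ℂ) * x / 2) * Complex.exp (-(M : ℂ) * x / 2)
      = Complex.exp (-(M : ℂ) * x) := by
    rw [← Complex.exp_add]; congr 1; ring
  rw [wC_eq hx.le, w0R, ← h2]
  push_cast
  rw [← h3]
  have h4 : (t - x) * ((t - x) ^ (-(1 / 2) : ℂ) * (t - x) ^ (-(1 / 2) : ℂ)) = 1 := by
    rw [h1, mul_inv_cancel₀ htx0]
  linear_combination (x : ℂ) * (Complex.exp (-(M : ℂ) * x / 2) * Complex.exp (-(M : ℂ) * x / 2))
    * (((x ^ (((M : ℝ) - N - 1) / 2) : ℝ) : ℂ) * ((x ^ (((M : ℝ) - N - 1) / 2) : ℝ) : ℂ)) * h4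

end Weight

theorem measurable_real_sign : Measurable Real.sign := by
  unfold Real.sign
  exact Measurable.ite measurableSet_Iio measurable_const
    (Measurable.ite measurableSet_Ioi measurable_const measurable_const)

theorem norm_sign_div_two_le (x : ℝ) : ‖((Real.sign x : ℝ) : ℂ) / 2‖ ≤ 1 := by
  rcases Real.sign_apply_eq x with h | h | h <;> rw [h] <;> norm_num

/-- If `F` vanishes at the endpoints of `(0, ∞)`, then `ε(F') = F`. -/
theorem epsC_deriv {F F' : ℝ → ℂ} (hcont : ContinuousOn F (Ici 0)) (h0 : F 0 = 0)
    (hderiv : ∀ x ∈ Ioi (0 : ℝ), HasDerivAt F (F' x) x) (hF : IntegrableOn F (Ioi 0))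
    (hF' : IntegrableOn F' (Ioi 0)) {x : ℝ} (hx : 0 < x) : epsC F' x = F x := by
  have hint : IntegrableOn (fun y => ((Real.sign (x - y) : ℝ) : ℂ) / 2 * F' y) (Ioi 0) := by
    refine Integrable.bdd_mul (c := 1) hF' ?_
      (Filter.Eventually.of_forall fun y => norm_sign_div_two_le _)
    refine Measurable.aestronglyMeasurable ?_
    have := measurable_real_sign
    fun_prop
  have hlim := tendsto_zero_of_hasDerivAt_of_integrableOn_Ioi hderiv hF' hF
  have hsub : Ioi x ⊆ Ioi (0 : ℝ) := Ioi_subset_Ioi hx.le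
  have hsub' : Ioc 0 x ⊆ Ioi (0 : ℝ) := Ioc_subset_Ioi_self
  have hr : ∫ y in Ioi x, F' y = 0 - F x :=
    integral_Ioi_of_hasDerivAt_of_tendsto ((hderiv x hx).continuousAt.continuousWithinAt)
      (fun y hy => hderiv y (hsub hy)) (hF'.mono_set hsub) hlim
  have hl : ∫ y in Ioc 0 x, F' y = F x - F 0 := by
    rw [← intervalIntegral.integral_of_le hx.le]
    exact intervalIntegral.integral_eq_sub_of_hasDerivAt_of_le hx.le
      (hcont.mono Icc_subset_Ici_self) (fun y hy => hderiv y hy.1)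
      ((intervalIntegrable_iff_integrableOn_Ioc_of_le hx.le).2 (hF'.mono_set hsub'))
  rw [epsC, ← Ioc_union_Ioi_eq_Ioi hx.le, setIntegral_union (Ioc_disjoint_Ioi le_rfl)
    measurableSet_Ioi (hint.mono_set hsub') (hint.mono_set hsub)]
  have e1 : ∫ y in Ioc 0 x, ((Real.sign (x - y) : ℝ) : ℂ) / 2 * F' y
      = 1 / 2 * ∫ y in Ioc 0 x, F' y := by
    rw [integral_Ioc_eq_integral_Ioo, integral_Ioc_eq_integral_Ioo, ← integral_const_mul]
    refine setIntegral_congr_fun measurableSet_Ioo fun y hy => ?_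
    simp only [Real.sign_of_pos (sub_pos.2 hy.2)]
    norm_num
  have e2 : ∫ y in Ioi x, ((Real.sign (x - y) : ℝ) : ℂ) / 2 * F' y
      = -(1 / 2) * ∫ y in Ioi x, F' y := by
    rw [← integral_const_mul]
    refine setIntegral_congr_fun measurableSet_Ioi fun y hy => ?_
    simp only [Real.sign_of_neg (sub_neg.2 hy)]
    norm_num
  rw [e1, e2, hl, hr, h0]
  ring

section SkewProduct

variable {M N : ℕ} {t : ℂ}

theorem epsC_Tq (hNM : N < M) (ht : t.im ≠ 0) (q : ℂ[X]) {x : ℝ} (hx : 0 < x) :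
    epsC (fun y => (Tq M N t q).eval (y : ℂ) * wC M N t y) x
      = q.eval (x : ℂ) * (x * (t - x)) * wC M N t x := by
  refine epsC_deriv (F := fun y => q.eval (y : ℂ) * (y * (t - y)) * wC M N t y) ?_ (by simp)
    (fun y hy => hasDerivAt_eval_mul_wC ht q hy) ?_ (integrableOn_eval_mul_wC hNM ht _) hx
  · refine ContinuousOn.mul (Continuous.continuousOn ?_) (continuousOn_wC hNM ht)
    fun_prop
  · refine (integrableOn_eval_mul_wC hNM ht (q * (X * (C t - X)))).congr_fun (fun y _ => ?_)
      measurableSet_Ioi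
    simp

theorem skew1_eq_integral_epsC (f g : ℂ[X]) :
    skew1 M N t f g = ∫ x in Ioi (0 : ℝ), f.eval (x : ℂ) * wC M N t x *
      epsC (fun y => g.eval (y : ℂ) * wC M N t y) x := by
  refine integral_congr_ae (Filter.Eventually.of_forall fun x => ?_)
  simp only [epsC, ← integral_const_mul]
  congr 1
  ext y
  ring

theorem skew1_Tq (hNM : N < M) (ht : t.im ≠ 0) (f q : ℂ[X]) :
    skew1 M N t f (Tq M N t q) = inner2C M N f q := by
  rw [skew1_eq_integral_epsC]
  refine setIntegral_congr_fun measurableSet_Ioi fun x hx => ?_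
  simp only [epsC_Tq hNM ht q hx, ← mul_wC_mul_wC hNM ht hx]
  ring

/-- The integrand of the skew product on `(0, ∞) × (0, ∞)`. -/
noncomputable def skewIntegrand (M N : ℕ) (t : ℂ) (f g : ℂ[X]) (z : ℝ × ℝ) : ℂ :=
  ((Real.sign (z.1 - z.2) : ℝ) : ℂ) / 2 *
    (f.eval (z.1 : ℂ) * wC M N t z.1 * (g.eval (z.2 : ℂ) * wC M N t z.2))

theorem integrable_skewIntegrand (hNM : N < M) (ht : t.im ≠ 0) (f g : ℂ[X]) :
    Integrable (skewIntegrand M N t f g)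
      ((volume.restrict (Ioi 0)).prod (volume.restrict (Ioi 0))) := by
  refine Integrable.bdd_mul (c := 1) (Integrable.mul_prod (integrableOn_eval_mul_wC hNM ht f)
    (integrableOn_eval_mul_wC hNM ht g)) ?_
    (Filter.Eventually.of_forall fun y => norm_sign_div_two_le _)
  refine Measurable.aestronglyMeasurable ?_
  have := measurable_real_sign
  fun_prop

theorem skew1_eq_integral_prod (hNM : N < M) (ht : t.im ≠ 0) (f g : ℂ[X]) :
    skew1 M N t f g = ∫ z, skewIntegrand M N t f g z
      ∂((volume.restrict (Ioi 0)).prod (volume.restrict (Ioi 0))) := by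
  rw [integral_prod _ (integrable_skewIntegrand hNM ht f g), skew1]
  simp only [skewIntegrand]
  congr 1
  ext x
  congr 1
  ext y
  ring

theorem skew1_swap (hNM : N < M) (ht : t.im ≠ 0) (f g : ℂ[X]) :
    skew1 M N t f g = -skew1 M N t g f := by
  rw [skew1_eq_integral_prod hNM ht, skew1_eq_integral_prod hNM ht, ← integral_neg,
    ← integral_prod_swap]
  congr 1
  ext z
  simp only [skewIntegrand, Prod.fst_swap, Prod.snd_swap]
  rw [← neg_sub z.1 z.2, Real.sign_neg]
  push_cast
  ring

/-- The skew product as a bilinear form. -/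
noncomputable def skewForm (hNM : N < M) (ht : t.im ≠ 0) : ℂ[X] →ₗ[ℂ] ℂ[X] →ₗ[ℂ] ℂ :=
  LinearMap.mk₂ ℂ (skew1 M N t)
    (fun f f' g => by
      simp only [skew1_eq_integral_prod hNM ht]
      rw [← integral_add (integrable_skewIntegrand hNM ht f g)
        (integrable_skewIntegrand hNM ht f' g)]
      congr 1
      ext z
      simp only [skewIntegrand, eval_add]
      ring)
    (fun c f g => by
      simp only [skew1_eq_integral_prod hNM ht, smul_eq_mul, ← integral_const_mul]
      congr 1
      ext z
      simp only [skewIntegrand, eval_smul, smul_eq_mul]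
      ring)
    (fun f g g' => by
      simp only [skew1_eq_integral_prod hNM ht]
      rw [← integral_add (integrable_skewIntegrand hNM ht f g)
        (integrable_skewIntegrand hNM ht f g')]
      congr 1
      ext z
      simp only [skewIntegrand, eval_add]
      ring)
    (fun c f g => by
      simp only [skew1_eq_integral_prod hNM ht, smul_eq_mul, ← integral_const_mul]
      congr 1
      ext z
      simp only [skewIntegrand, eval_smul, smul_eq_mul]
      ring)

end SkewProduct

section LaguerreFunctional

variable {M : ℕ}

theorem integrableOn_eval_mul_w0R (hM : 0 < M) (N : ℕ) (p : ℂ[X]) :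
    IntegrableOn (fun x : ℝ => p.eval (x : ℂ) * (w0R M N x : ℂ)) (Ioi 0) := by
  induction p using Polynomial.induction_on' with
  | add p q hp hq =>
    refine (hp.add hq).congr_fun (fun x _ => ?_) measurableSet_Ioi
    simp [add_mul]
  | monomial k a =>
    have h1 := ((integrableOn_rpow_mul_exp_neg_mul_rpow (s := ((M - N + k : ℕ) : ℝ))
      (neg_one_lt_zero.trans_le (Nat.cast_nonneg _)) one_pos
      (Nat.cast_pos.2 hM : (0 : ℝ) < M)).ofReal (𝕜 := ℂ)).const_mul a
    refine IntegrableOn.congr_fun h1 (fun x hx => ?_) measurableSet_Ioi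
    simp only [eval_monomial, w0R, Real.rpow_one, Real.rpow_natCast,
      RCLike.ofReal_eq_complex_ofReal, pow_add]
    push_cast
    ring

/-- Integration against the Laguerre weight. -/
noncomputable def laguerreFunctional (hM : 0 < M) (N : ℕ) : ℂ[X] →ₗ[ℂ] ℂ where
  toFun p := ∫ x in Ioi (0 : ℝ), p.eval (x : ℂ) * (w0R M N x : ℂ)
  map_add' p q := by
    rw [← integral_add (integrableOn_eval_mul_w0R hM N p) (integrableOn_eval_mul_w0R hM N q)]
    simp only [eval_add, add_mul]
  map_smul' c p := by
    rw [RingHom.id_apply, smul_eq_mul, ← integral_const_mul]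
    simp only [eval_smul, smul_eq_mul, mul_assoc]

theorem laguerreFunctional_mul (hM : 0 < M) (N : ℕ) (p q : ℂ[X]) :
    laguerreFunctional hM N (p * q) = inner2C M N p q := by
  simp [laguerreFunctional, inner2C]

theorem laguerreFunctional_X_pow (hM : 0 < M) (N k : ℕ) :
    laguerreFunctional hM N (X ^ k) = ((M - N + k).factorial : ℂ) / (M : ℂ) ^ (M - N + k + 1) := by
  have h := Real.integral_rpow_mul_exp_neg_mul_Ioi (a := ((M - N + k : ℕ) : ℝ) + 1)
    (by positivity) (Nat.cast_pos.2 hM : (0 : ℝ) < M)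
  have e : laguerreFunctional hM N (X ^ k)
      = ∫ x in Ioi (0 : ℝ), ((x ^ ((((M - N + k : ℕ) : ℝ) + 1) - 1)
          * Real.exp (-(M * x)) : ℝ) : ℂ) := by
    refine setIntegral_congr_fun measurableSet_Ioi fun x hx => ?_
    simp only [eval_pow, eval_X, w0R, add_sub_cancel_right, Real.rpow_natCast, pow_add, neg_mul]
    push_cast
    ring
  rw [e, integral_complex_ofReal, h, Real.Gamma_nat_eq_factorial, ← Nat.cast_succ,
    Real.rpow_natCast]
  push_cast
  rw [one_div, inv_pow, Nat.succ_eq_add_one]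
  ring

theorem laguerreFunctional_pearson (hM : 0 < M) {N : ℕ} (hNM : N < M) (p : ℂ[X]) :
    laguerreFunctional hM N (X * derivative p) + ((M : ℂ) - N + 1) * laguerreFunctional hM N p
      = M * laguerreFunctional hM N (X * p) := by
  have hM0 : (M : ℂ) ≠ 0 := Nat.cast_ne_zero.2 hM.ne'
  induction p using Polynomial.induction_on' with
  | add p q hp hq =>
    simp only [mul_add, map_add] at hp hq ⊢
    linear_combination hp + hq
  | monomial k a =>
    have e1 : X * derivative (monomial k a) = (a * k) • (X ^ k : ℂ[X]) := by
      cases k with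
      | zero => simp
      | succ k =>
        rw [derivative_monomial, X_mul_monomial, smul_X_eq_monomial, Nat.add_sub_cancel]
    have e2 : X * monomial k a = a • (X ^ (k + 1) : ℂ[X]) := by
      rw [X_mul_monomial, smul_X_eq_monomial]
    have e3 : monomial k a = a • (X ^ k : ℂ[X]) := by rw [smul_X_eq_monomial]
    rw [e1, e2, e3]
    simp only [map_smul, smul_eq_mul, laguerreFunctional_X_pow]
    rw [← add_assoc (M - N) k 1, Nat.factorial_succ, pow_succ (M : ℂ) (M - N + k + 1)]
    push_cast [Nat.cast_sub hNM.le]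
    field_simp
    ring

end LaguerreFunctional

/-- Assume `N` is even, `N ≥ 6`, and
`⟨L_{N−1},L_{N−2}⟩₁·⟨L_{N−3},L_{N−4}⟩₁ ≠ 0`.  Then
`⟨L_{N+1}, L_{N−1}⟩₁ = ((N−1)(M−1)/M²)·⟨L_N, L_{N−2}⟩₁` and
`⟨L_{N+1}, L_{N−2}⟩₁ = ((Mt − (N+M))/M)·⟨L_N, L_{N−2}⟩₁`. -/
theorem stmt_12 (M N : ℕ) (hNe : Even N) (hN : 6 ≤ N) (hNM : N < M)
    (t : ℂ) (ht : t.im ≠ 0)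
    (L : ℕ → Polynomial ℂ) (hL : IsLag M N L)
    (hne : skew1 M N t (L (N - 1)) (L (N - 2)) *
        skew1 M N t (L (N - 3)) (L (N - 4)) ≠ 0) :
    skew1 M N t (L (N + 1)) (L (N - 1))
        = ((N : ℂ) - 1) * ((M : ℂ) - 1) / (M : ℂ) ^ 2 *
            skew1 M N t (L N) (L (N - 2)) ∧
      skew1 M N t (L (N + 1)) (L (N - 2))
        = ((M : ℂ) * t - ((N : ℂ) + (M : ℂ))) / (M : ℂ) *
            skew1 M N t (L N) (L (N - 2)) := by
  have hM : 0 < M := Nat.zero_lt_of_lt hNM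
  obtain ⟨n, rfl⟩ : ∃ n, N = n + 2 := ⟨N - 2, by omega⟩
  have hα : ∀ k : ℕ, (k : ℂ) + 1 + ((M : ℂ) - (n + 2 : ℕ)) ≠ 0 := fun k => by
    rw [← Nat.cast_sub hNM.le]
    exact_mod_cast (by omega : k + 1 + (M - (n + 2)) ≠ 0)
  have h1 : laguerreFunctional hM (n + 2) 1 ≠ 0 := by
    rw [← pow_zero X, laguerreFunctional_X_pow]
    exact div_ne_zero (Nat.cast_ne_zero.2 (Nat.factorial_ne_zero _))
      (pow_ne_zero _ (Nat.cast_ne_zero.2 hM.ne'))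
  have key := skew_product_identities M (n + 2) t (laguerreFunctional hM (n + 2))
    (skewForm hNM ht) L (Nat.cast_ne_zero.2 hM.ne') (fun k => (hL k).1) (fun k => (hL k).2.1)
    (fun k j hj => by rw [laguerreFunctional_mul]; exact (hL k).2.2 j hj)
    (skew1_swap hNM ht)
    (fun f q => by rw [laguerreFunctional_mul]; exact skew1_Tq hNM ht f q)
    (laguerreFunctional_pearson hM hNM) hα h1 n (left_ne_zero_of_mul hne)
  refine ⟨Eq.trans key.1 ?_, Eq.trans key.2 ?_⟩
  · change _ * skew1 M (n + 2) t (L (n + 2)) (L n) = _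
    push_cast
    congr 2
    ring
  · change _ * skew1 M (n + 2) t (L (n + 2)) (L n) = _
    push_cast
    congr 2
    ring
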